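/- Suppose (R, β) is locally ubiquitous in I₀ with respect to ρ, and let Ψ be an approximating function such that Ψ(2^{t+1}) ≤ (1/2) Ψ(2^t) for all sufficiently large t. If ∑_{t=1}^∞ Ψ(2^t)/ρ(2^t) = ∞, then Λ(R, β, Ψ) has full Lebesgue measure in I₀, i.e. |Λ(R, β, Ψ)| = |I₀|. -/

import Mathlib

open MeasureTheory Filter

/-- An approximating function: a decreasing function `ℝ₊ → ℝ₊` taking positive values. -/
def IsApproxFun (Ψ : ℝ → ℝ) : Prop :=
  (∀ x y : ℝ, 0 < x → x ≤ y → Ψ y ≤ Ψ x) ∧ ∀ x : ℝ, 0 < x → 0 < Ψ x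

/-- The system `(R, β)` is locally ubiquitous in `I₀` with respect to `ρ`. -/
def LocUbiq (I₀ : Set ℝ) {J : Type*} (R : J → ℝ) (β : J → ℝ) (ρ : ℝ → ℝ) : Prop :=
  ∃ κ : ℝ, 0 < κ ∧ ∀ I ⊆ I₀, I.OrdConnected →
    ENNReal.ofReal κ * volume I ≤
      liminf (fun t : ℕ =>
        volume (⋃ α ∈ {α : J | β α ≤ (2 : ℝ) ^ t},
          Metric.ball (R α) (ρ ((2 : ℝ) ^ t)) ∩ I)) atTop

/-- The limsup set `Λ(R, β, Ψ)`. -/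
def LambdaSet (I₀ : Set ℝ) {J : Type*} (R : J → ℝ) (β : J → ℝ) (Ψ : ℝ → ℝ) : Set ℝ :=
  {x | x ∈ I₀ ∧ {α : J | |x - R α| < Ψ (β α)}.Infinite}

open scoped Topology

/-- The weighted Chung–Erdős inequality: a lower bound on the measure of a set containing a finite
family of sets in terms of the measures of the members and of their pairwise intersections. -/
theorem sq_sum_measureReal_le {Ω ι : Type*} [MeasurableSpace Ω] {μ : Measure Ω} (T : Finset ι)
    {B : ι → Set Ω} {U : Set Ω} (hB : ∀ i ∈ T, MeasurableSet (B i)) (hU : MeasurableSet U)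
    (hUfin : μ U ≠ ⊤) (hBU : ∀ i ∈ T, B i ⊆ U) :
    (∑ i ∈ T, μ.real (B i)) ^ 2 ≤ μ.real U * ∑ i ∈ T, ∑ j ∈ T, μ.real (B i ∩ B j) := by
  have hBfin : ∀ i ∈ T, μ (B i) ≠ ⊤ := fun i hi => measure_ne_top_of_subset (hBU i hi) hUfin
  have hint : ∀ s : Set Ω, MeasurableSet s → μ s ≠ ⊤ →
      Integrable (s.indicator (fun _ => (1 : ℝ))) μ := fun s hs hfin =>
    (integrable_indicator_iff hs).2 (integrableOn_const hfin)
  have hval : ∀ s : Set Ω, MeasurableSet s → ∫ x, s.indicator (fun _ => (1 : ℝ)) x ∂μ = μ.real s := by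
    intro s hs
    rw [integral_indicator hs]
    simp
  have hquad : ∀ l : ℝ, 0 ≤ μ.real U * (l * l) + (-2 * ∑ i ∈ T, μ.real (B i)) * l
      + ∑ i ∈ T, ∑ j ∈ T, μ.real (B i ∩ B j) := by
    intro l
    have hexp : ∀ x, (l * U.indicator (fun _ => (1 : ℝ)) x
        - ∑ i ∈ T, (B i).indicator (fun _ => (1 : ℝ)) x) ^ 2
        = l * l * U.indicator (fun _ => (1 : ℝ)) x
          + (-2 * l) * ∑ i ∈ T, (B i).indicator (fun _ => (1 : ℝ)) x
          + ∑ i ∈ T, ∑ j ∈ T, (B i ∩ B j).indicator (fun _ => (1 : ℝ)) x := by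
      intro x
      have hprod : ∑ i ∈ T, ∑ j ∈ T, (B i ∩ B j).indicator (fun _ => (1 : ℝ)) x
          = (∑ i ∈ T, (B i).indicator (fun _ => (1 : ℝ)) x) ^ 2 := by
        rw [sq, Finset.sum_mul_sum]
        refine Finset.sum_congr rfl fun i _ => Finset.sum_congr rfl fun j _ => ?_
        rw [← Set.inter_indicator_mul]
        simp
      have hcross : U.indicator (fun _ => (1 : ℝ)) x * ∑ i ∈ T, (B i).indicator (fun _ => (1 : ℝ)) x
          = ∑ i ∈ T, (B i).indicator (fun _ => (1 : ℝ)) x := by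
        rw [Finset.mul_sum]
        refine Finset.sum_congr rfl fun i hi => ?_
        rw [← Set.inter_indicator_mul, Set.inter_eq_right.2 (hBU i hi)]
        simp
      have hUU : U.indicator (fun _ => (1 : ℝ)) x * U.indicator (fun _ => (1 : ℝ)) x
          = U.indicator (fun _ => (1 : ℝ)) x := by
        by_cases hx : x ∈ U <;> simp [hx]
      rw [hprod]
      linear_combination (l * l) * hUU - 2 * l * hcross
    have hIB : Integrable (fun x => ∑ i ∈ T, (B i).indicator (fun _ => (1 : ℝ)) x) μ :=
      integrable_finsetSum _ fun i hi => hint _ (hB i hi) (hBfin i hi)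
    have hIBB : ∀ i ∈ T, ∀ j ∈ T,
        Integrable (fun x => (B i ∩ B j).indicator (fun _ => (1 : ℝ)) x) μ := fun i hi j hj =>
      hint _ ((hB i hi).inter (hB j hj)) (measure_ne_top_of_subset Set.inter_subset_left (hBfin i hi))
    have hIsum : Integrable
        (fun x => ∑ i ∈ T, ∑ j ∈ T, (B i ∩ B j).indicator (fun _ => (1 : ℝ)) x) μ :=
      integrable_finsetSum _ fun i hi => integrable_finsetSum _ fun j hj => hIBB i hi j hj
    have hnonneg : 0 ≤ ∫ x, (l * U.indicator (fun _ => (1 : ℝ)) x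
        - ∑ i ∈ T, (B i).indicator (fun _ => (1 : ℝ)) x) ^ 2 ∂μ :=
      integral_nonneg fun x => sq_nonneg _
    simp_rw [hexp] at hnonneg
    have hIlin : Integrable (fun x => l * l * U.indicator (fun _ => (1 : ℝ)) x
        + (-2 * l) * ∑ i ∈ T, (B i).indicator (fun _ => (1 : ℝ)) x) μ :=
      ((hint U hU hUfin).const_mul _).add (hIB.const_mul _)
    rw [integral_add hIlin hIsum,
      integral_add ((hint U hU hUfin).const_mul _) (hIB.const_mul _), integral_const_mul,
      integral_const_mul, hval U hU,
      integral_finsetSum _ (fun i hi => hint _ (hB i hi) (hBfin i hi)),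
      integral_finsetSum _ (fun i hi => integrable_finsetSum _ fun j hj => hIBB i hi j hj),
      Finset.sum_congr rfl (fun i hi => hval _ (hB i hi)),
      Finset.sum_congr rfl (fun i hi => (integral_finsetSum _ (hIBB i hi)).trans
        (Finset.sum_congr rfl fun j hj => hval _ ((hB i hi).inter (hB j hj))))] at hnonneg
    linarith
  have hdisc := discrim_le_zero hquad
  rw [discrim] at hdisc
  nlinarith

/-- Every finite set of reals has a `δ`-separated `δ`-net. -/
theorem Finset.exists_separated_net (P : Finset ℝ) (δ : ℝ) :
    ∃ G ⊆ P, (G : Set ℝ).Pairwise (fun c d => δ ≤ dist c d) ∧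
      ∀ p ∈ P, p ∈ G ∨ ∃ c ∈ G, dist p c < δ := by
  classical
  induction P using Finset.induction_on with
  | empty => exact ⟨∅, by simp⟩
  | insert a P ha ih =>
    obtain ⟨G, hGP, hsep, hnet⟩ := ih
    by_cases h : ∃ c ∈ G, dist a c < δ
    · refine ⟨G, hGP.trans (Finset.subset_insert _ _), hsep, fun p hp => ?_⟩
      rcases Finset.mem_insert.1 hp with rfl | hp
      · exact Or.inr h
      · exact hnet p hp
    · push Not at h
      refine ⟨insert a G, Finset.insert_subset_insert _ hGP, ?_, fun p hp => ?_⟩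
      · rw [Finset.coe_insert, Set.pairwise_insert]
        exact ⟨hsep, fun c hc _ => ⟨h c hc, dist_comm a c ▸ h c hc⟩⟩
      · rcases Finset.mem_insert.1 hp with rfl | hp
        · exact Or.inl (Finset.mem_insert_self _ _)
        · rcases hnet p hp with hp | ⟨c, hc, hpc⟩
          · exact Or.inl (Finset.mem_insert_of_mem hp)
          · exact Or.inr ⟨c, Finset.mem_insert_of_mem hc, hpc⟩

/-- A packing bound for separated sets of reals. -/
theorem card_mul_le_of_separated {G : Finset ℝ} {δ y w : ℝ} (hδ : 0 < δ) (hw : 0 ≤ w)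
    (hsep : (G : Set ℝ).Pairwise (fun c d => δ ≤ dist c d)) (hG : ∀ c ∈ G, dist c y < w) :
    (G.card : ℝ) * δ ≤ 2 * w + δ := by
  have hdisj : (G : Set ℝ).PairwiseDisjoint (fun c => Metric.ball c (δ / 2)) := fun c hc d hd hcd =>
    Metric.ball_disjoint_ball (by linarith [hsep hc hd hcd])
  have hsub : ⋃ c ∈ G, Metric.ball c (δ / 2) ⊆ Metric.ball y (w + δ / 2) :=
    Set.iUnion₂_subset fun c hc => Metric.ball_subset_ball' (by linarith [hG c hc])
  have hle := measure_mono (μ := volume) hsub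
  rw [measure_biUnion_finset hdisj fun _ _ => measurableSet_ball] at hle
  simp only [Real.volume_ball, Finset.sum_const, nsmul_eq_mul] at hle
  rw [← ENNReal.ofReal_natCast, ← ENNReal.ofReal_mul (by positivity),
    ENNReal.ofReal_le_ofReal_iff (by positivity)] at hle
  linarith

/-- A tail of a sequence that is at least halved at every step is at most twice its first term. -/
theorem sum_Ico_le_two_mul_of_halving {ψ : ℕ → ℝ} {m : ℕ} (hψ : ∀ t, 0 ≤ ψ t)
    (hhalf : ∀ t ≥ m, ψ (t + 1) ≤ ψ t / 2) {s : ℕ} (hs : m ≤ s) (N : ℕ) :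
    ∑ t ∈ Finset.Ico s N, ψ t ≤ 2 * ψ s := by
  rcases le_or_gt s N with hsN | hsN
  · have : ∑ t ∈ Finset.Ico s N, ψ t + 2 * ψ N ≤ 2 * ψ s := by
      induction N, hsN using Nat.le_induction with
      | base => simp
      | succ n hn ih =>
        rw [Finset.sum_Ico_succ_top hn]
        linarith [hhalf n (hs.trans hn)]
    linarith [hψ N]
  · rw [Finset.Ico_eq_empty (by omega)]
    simpa using hψ s

/-- The total overlap of a ball with smaller balls centred at a separated set. -/
theorem sum_measureReal_ball_inter_ball_le {H : Finset ℝ} {δ a b : ℝ} (hδ : 0 < δ) (hb : 0 < b)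
    (hba : b ≤ a) (hsep : (H : Set ℝ).Pairwise (fun c d => δ ≤ dist c d)) (c : ℝ) :
    ∑ d ∈ H, volume.real (Metric.ball c a ∩ Metric.ball d b) ≤ (1 + 4 * (a / δ)) * (2 * b) := by
  set H' := H.filter (fun d => dist d c < a + b) with hH'
  have hcard : (H'.card : ℝ) * δ ≤ 2 * (a + b) + δ :=
    card_mul_le_of_separated (y := c) hδ (by linarith)
      (hsep.mono (Finset.coe_subset.2 (Finset.filter_subset _ _)))
      fun d hd => (Finset.mem_filter.1 hd).2
  have hcard' : (H'.card : ℝ) ≤ 1 + 4 * (a / δ) := by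
    rw [← mul_div_assoc, ← sub_le_iff_le_add', le_div_iff₀ hδ]
    linarith
  calc ∑ d ∈ H, volume.real (Metric.ball c a ∩ Metric.ball d b)
      = ∑ d ∈ H', volume.real (Metric.ball c a ∩ Metric.ball d b) := by
        refine (Finset.sum_subset (Finset.filter_subset _ _) fun d hd hd' => ?_).symm
        have hdist : a + b ≤ dist c d := by
          rw [dist_comm]
          exact not_lt.1 fun h => hd' (Finset.mem_filter.2 ⟨hd, h⟩)
        rw [(Metric.ball_disjoint_ball hdist).inter_eq, measureReal_empty]
    _ ≤ ∑ d ∈ H', 2 * b := by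
        refine Finset.sum_le_sum fun d _ => ?_
        rw [← Real.volume_real_ball (a := d) hb.le]
        exact measureReal_mono Set.inter_subset_right measure_ball_lt_top.ne
    _ ≤ (1 + 4 * (a / δ)) * (2 * b) := by
        rw [Finset.sum_const, nsmul_eq_mul]
        gcongr

/-- Finitely many levels of balls with separated, numerous centres cover a fixed proportion of the
region they are contained in. -/
theorem le_measureReal_of_separated_centres {G : ℕ → Finset ℝ} {δ ψ : ℕ → ℝ} {m N : ℕ}
    {κ r : ℝ} {U : Set ℝ} (hr : 0 < r) (hκ : 0 < κ) (hδ : ∀ t, 0 < δ t) (hψ : ∀ t, 0 < ψ t)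
    (hanti : Antitone ψ) (hhalf : ∀ t ≥ m, ψ (t + 1) ≤ ψ t / 2)
    (hsep : ∀ t ≥ m, (G t : Set ℝ).Pairwise (fun c d => δ t ≤ dist c d))
    (hupper : ∀ t ≥ m, ((G t).card : ℝ) * δ t ≤ 2 * r)
    (hlower : ∀ t ≥ m, κ * r ≤ (G t).card * (4 * δ t))
    (hsum : 1 ≤ ∑ t ∈ Finset.Ico m N, ψ t / δ t)
    (hU : MeasurableSet U) (hUfin : volume U ≠ ⊤)
    (hsub : ∀ t ≥ m, ∀ c ∈ G t, Metric.ball c (ψ t) ⊆ U) :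
    κ ^ 2 / 192 * r ≤ volume.real U := by
  set S := ∑ t ∈ Finset.Ico m N, ψ t / δ t with hS
  set q : ℕ → ℕ → ℝ := fun s t => ∑ c ∈ G s, ∑ d ∈ G t,
    volume.real (Metric.ball c (ψ s) ∩ Metric.ball d (ψ t)) with hq
  have hqsymm : ∀ s t, q s t = q t s := fun s t => by
    simp only [hq]
    rw [Finset.sum_comm]
    simp only [Set.inter_comm]
  have hCE := sq_sum_measureReal_le (μ := volume) ((Finset.Ico m N).sigma G)
    (B := fun p => Metric.ball p.2 (ψ p.1)) (fun _ _ => measurableSet_ball) hU hUfin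
    (fun p hp => by
      rw [Finset.mem_sigma, Finset.mem_Ico] at hp
      exact hsub p.1 hp.1.1 p.2 hp.2)
  have hQ : ∑ p ∈ (Finset.Ico m N).sigma G, ∑ p' ∈ (Finset.Ico m N).sigma G,
      volume.real (Metric.ball p.2 (ψ p.1) ∩ Metric.ball p'.2 (ψ p'.1))
      = ∑ s ∈ Finset.Ico m N, ∑ t ∈ Finset.Ico m N, q s t := by
    rw [Finset.sum_sigma]
    refine Finset.sum_congr rfl fun s _ => ?_
    simp only [Finset.sum_sigma, hq]
    exact Finset.sum_comm
  have hM : κ * r / 2 * S ≤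
      ∑ p ∈ (Finset.Ico m N).sigma G, volume.real (Metric.ball p.2 (ψ p.1)) := by
    rw [Finset.sum_sigma, hS, Finset.mul_sum]
    refine Finset.sum_le_sum fun t ht => ?_
    simp only [Real.volume_real_ball (hψ t).le, Finset.sum_const, nsmul_eq_mul]
    rw [← mul_div_assoc, div_le_iff₀ (hδ t)]
    nlinarith [mul_le_mul_of_nonneg_right (hlower t (Finset.mem_Ico.1 ht).1) (hψ t).le]
  have hqle : ∀ s ≥ m, ∀ t ≥ s,
      q s t ≤ 4 * r / δ s * ψ t + 16 * r * (ψ s / δ s) * (ψ t / δ t) := by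
    intro s hs t hst
    have hcard : ((G s).card : ℝ) ≤ 2 * r / δ s := by
      rw [le_div_iff₀ (hδ s)]
      exact hupper s hs
    have hpos : 0 ≤ (1 + 4 * (ψ s / δ t)) * (2 * ψ t) := by
      have := hψ s; have := hψ t; have := hδ t
      positivity
    calc q s t ≤ ∑ c ∈ G s, (1 + 4 * (ψ s / δ t)) * (2 * ψ t) :=
          Finset.sum_le_sum fun c _ => sum_measureReal_ball_inter_ball_le (hδ t) (hψ t)
            (hanti hst) (hsep t (hs.trans hst)) c
      _ = (G s).card * ((1 + 4 * (ψ s / δ t)) * (2 * ψ t)) := by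
          rw [Finset.sum_const, nsmul_eq_mul]
      _ ≤ 2 * r / δ s * ((1 + 4 * (ψ s / δ t)) * (2 * ψ t)) := by gcongr
      _ = 4 * r / δ s * ψ t + 16 * r * (ψ s / δ s) * (ψ t / δ t) := by ring
  set p : ℕ → ℕ → ℝ := fun s t =>
    (if s ≤ t then 4 * r / δ s * ψ t else 0) + 16 * r * (ψ s / δ s) * (ψ t / δ t) with hp
  have hpnonneg : ∀ s t, 0 ≤ p s t := fun s t => by
    have := hψ s; have := hψ t; have := hδ s; have := hδ t
    simp only [hp]
    split_ifs <;> positivity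
  have hqp : ∀ s ∈ Finset.Ico m N, ∀ t ∈ Finset.Ico m N, q s t ≤ p s t + p t s := by
    intro s hs t ht
    rw [Finset.mem_Ico] at hs ht
    rcases le_total s t with h | h
    · have := hqle s hs.1 t h
      have := hpnonneg t s
      simp only [hp, if_pos h] at *
      linarith
    · have := hqle t ht.1 s h
      have := hpnonneg s t
      rw [hqsymm]
      simp only [hp, if_pos h] at *
      linarith
  have hpsum : ∑ s ∈ Finset.Ico m N, ∑ t ∈ Finset.Ico m N, p s t ≤ 8 * r * S + 16 * r * S ^ 2 := by
    have h₁ : ∀ s ∈ Finset.Ico m N,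
        ∑ t ∈ Finset.Ico m N, (if s ≤ t then 4 * r / δ s * ψ t else 0) ≤ 8 * r * (ψ s / δ s) := by
      intro s hs
      rw [Finset.mem_Ico] at hs
      rw [← Finset.sum_filter, ← Finset.mul_sum]
      have hfilter : (Finset.Ico m N).filter (fun t => s ≤ t) = Finset.Ico s N := by
        ext t
        simp only [Finset.mem_filter, Finset.mem_Ico]
        omega
      rw [hfilter]
      have := hδ s
      calc 4 * r / δ s * ∑ t ∈ Finset.Ico s N, ψ t ≤ 4 * r / δ s * (2 * ψ s) := by
            gcongr
            exact sum_Ico_le_two_mul_of_halving (fun t => (hψ t).le) hhalf hs.1 N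
        _ = 8 * r * (ψ s / δ s) := by ring
    have h₂ : ∑ s ∈ Finset.Ico m N, ∑ t ∈ Finset.Ico m N, 16 * r * (ψ s / δ s) * (ψ t / δ t)
        = 16 * r * S ^ 2 := by
      rw [sq, hS, Finset.sum_mul_sum, Finset.mul_sum]
      refine Finset.sum_congr rfl fun s _ => ?_
      rw [Finset.mul_sum]
      exact Finset.sum_congr rfl fun t _ => by ring
    simp only [hp, Finset.sum_add_distrib]
    rw [h₂, hS, Finset.mul_sum]
    gcongr with s hs
    exact h₁ s hs
  have hqsum : ∑ s ∈ Finset.Ico m N, ∑ t ∈ Finset.Ico m N, q s t ≤ 48 * r * S ^ 2 := by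
    calc ∑ s ∈ Finset.Ico m N, ∑ t ∈ Finset.Ico m N, q s t
        ≤ ∑ s ∈ Finset.Ico m N, ∑ t ∈ Finset.Ico m N, (p s t + p t s) :=
          Finset.sum_le_sum fun s hs => Finset.sum_le_sum fun t ht => hqp s hs t ht
      _ = 2 * ∑ s ∈ Finset.Ico m N, ∑ t ∈ Finset.Ico m N, p s t := by
          simp only [Finset.sum_add_distrib]
          rw [Finset.sum_comm (f := fun s t => p t s)]
          ring
      _ ≤ 2 * (8 * r * S + 16 * r * S ^ 2) := by gcongr
      _ ≤ 48 * r * S ^ 2 := by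
          nlinarith [mul_nonneg hr.le
            (mul_nonneg (sub_nonneg.2 hsum) (zero_le_one.trans hsum))]
  rw [hQ] at hCE
  have hSpos : 0 < S := zero_lt_one.trans_le hsum
  have hfinal : (κ * r / 2 * S) ^ 2 ≤ volume.real U * (48 * r * S ^ 2) :=
    (pow_le_pow_left₀ (by positivity) hM 2).trans
      (hCE.trans (mul_le_mul_of_nonneg_left hqsum measureReal_nonneg))
  have hpos : 0 < 48 * r * S ^ 2 := by positivity
  refine le_of_mul_le_mul_right (le_of_eq_of_le ?_ hfinal) hpos
  ring

/-- From a finite set of centres whose `δ`-balls cover a proportion of a ball one can extract a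
`δ`-separated subset of comparable covering power. -/
theorem exists_separated_centres {P : Set ℝ} (hP : P.Finite) {δ κ y r : ℝ} (hδ : 0 < δ)
    (hr : 0 < r) (hδr : δ ≤ r / 4)
    (hcover : ENNReal.ofReal (κ * r) ≤ volume (⋃ c ∈ P, Metric.ball c δ ∩ Metric.ball y (r / 2))) :
    ∃ G : Finset ℝ, (G : Set ℝ) ⊆ P ∧ (∀ c ∈ G, dist c y < 3 * r / 4) ∧
      (G : Set ℝ).Pairwise (fun c d => δ ≤ dist c d) ∧ (G.card : ℝ) * δ ≤ 2 * r ∧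
      κ * r ≤ G.card * (4 * δ) := by
  classical
  obtain ⟨G, hG, hsep, hnet⟩ :=
    (hP.toFinset.filter (fun c => dist c y < 3 * r / 4)).exists_separated_net δ
  have hGP : ∀ c ∈ G, c ∈ P ∧ dist c y < 3 * r / 4 := fun c hc => by
    simpa using hG hc
  refine ⟨G, fun c hc => (hGP c hc).1, fun c hc => (hGP c hc).2, hsep, ?_, ?_⟩
  · linarith [card_mul_le_of_separated hδ (by positivity) hsep fun c hc => (hGP c hc).2]
  · have hsub : ⋃ c ∈ P, Metric.ball c δ ∩ Metric.ball y (r / 2) ⊆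
        ⋃ c ∈ G, Metric.ball c (2 * δ) := by
      refine Set.iUnion₂_subset fun p hp x hx => ?_
      have hxp : dist x p < δ := hx.1
      have hxy : dist x y < r / 2 := hx.2
      have hpy : dist p y < 3 * r / 4 := by
        linarith [dist_triangle_left p y x]
      rw [Set.mem_iUnion₂]
      rcases hnet p (by simp [hp, hpy]) with hpG | ⟨c, hc, hpc⟩
      · exact ⟨p, hpG, Metric.mem_ball.2 (by linarith)⟩
      · exact ⟨c, hc, Metric.mem_ball.2 (by linarith [dist_triangle x p c])⟩
    have hle := (hcover.trans (measure_mono hsub)).trans (measure_biUnion_finset_le _ _)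
    simp only [Real.volume_ball, Finset.sum_const, nsmul_eq_mul] at hle
    rw [← ENNReal.ofReal_natCast, ← ENNReal.ofReal_mul (by positivity),
      ENNReal.ofReal_le_ofReal_iff (by positivity)] at hle
    linarith

/-- If `δ`-neighbourhoods of finite sets cover a proportion of a ball at every late level, then
`∑ ψ / δ = ∞` forces the `ψ`-neighbourhoods of the late levels to cover a proportion as well. -/
theorem le_measureReal_iUnion_inter_ball {P : ℕ → Set ℝ} (hP : ∀ t, (P t).Finite) {δ ψ : ℕ → ℝ}
    {κ y r : ℝ} (hr : 0 < r) (hκ : 0 < κ) (hδ : ∀ t, 0 < δ t) (hδ₀ : Tendsto δ atTop (𝓝 0))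
    (hψ : ∀ t, 0 < ψ t) (hψ₀ : Tendsto ψ atTop (𝓝 0)) (hanti : Antitone ψ)
    (hhalf : ∀ᶠ t in atTop, ψ (t + 1) ≤ ψ t / 2) (hdiv : ¬ Summable fun t => ψ t / δ t)
    (hcover : ∀ᶠ t in atTop, ENNReal.ofReal (κ * r) ≤
      volume (⋃ c ∈ P t, Metric.ball c (δ t) ∩ Metric.ball y (r / 2))) (M : ℕ) :
    κ ^ 2 / 192 * r ≤
      volume.real ((⋃ t ≥ M, ⋃ c ∈ P t, Metric.ball c (ψ t)) ∩ Metric.ball y r) := by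
  obtain ⟨m, hm⟩ := eventually_atTop.1 ((eventually_ge_atTop M).and (hhalf.and (hcover.and
    ((hδ₀.eventually_le_const (by positivity : 0 < r / 4)).and
      (hψ₀.eventually_le_const (by positivity : 0 < r / 4))))))
  choose! G hGP hGy hsep hupper hlower using fun t (ht : t ≥ m) =>
    exists_separated_centres (hP t) (hδ t) hr (hm t ht).2.2.2.1 (hm t ht).2.2.1
  have hnonneg : ∀ t, 0 ≤ ψ t / δ t := fun t => (div_pos (hψ t) (hδ t)).le
  obtain ⟨N, hN, hmN⟩ := (((not_summable_iff_tendsto_nat_atTop_of_nonneg hnonneg).1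
    hdiv).eventually_ge_atTop (∑ t ∈ Finset.range m, ψ t / δ t + 1)).and
      (eventually_ge_atTop m) |>.exists
  have hsum : 1 ≤ ∑ t ∈ Finset.Ico m N, ψ t / δ t := by
    rw [Finset.sum_Ico_eq_sub _ hmN]
    linarith
  refine le_measureReal_of_separated_centres hr hκ hδ hψ hanti (fun t ht => (hm t ht).2.1) hsep
    hupper hlower hsum ?_ (measure_ne_top_of_subset Set.inter_subset_right measure_ball_lt_top.ne)
    fun t ht c hc => Set.subset_inter ?_ (Metric.ball_subset_ball' ?_)
  · exact ((isOpen_biUnion fun t _ => isOpen_biUnion fun c _ =>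
      Metric.isOpen_ball).inter Metric.isOpen_ball).measurableSet
  · intro x hx
    simp only [Set.mem_iUnion]
    exact ⟨t, (hm t ht).1, c, hGP t ht hc, hx⟩
  · linarith [hGy t ht c hc, (hm t ht).2.2.2.2]

/-- A measurable set of reals that occupies a fixed proportion of every small ball centred in an
open set has full measure in that open set. -/
theorem ae_mem_of_le_measure_inter_ball {L V : Set ℝ} (hL : MeasurableSet L) (hV : IsOpen V)
    {k : ℝ} (hk : 0 < k) (hdens : ∀ y r : ℝ, 0 < r → Metric.ball y r ⊆ V →
      ENNReal.ofReal (k * r) ≤ volume (L ∩ Metric.ball y r)) :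
    ∀ᵐ x, x ∈ V → x ∈ L := by
  filter_upwards [Besicovitch.ae_tendsto_measure_inter_div_of_measurableSet volume hL] with x hx hxV
  by_contra hxL
  rw [Set.indicator_of_notMem hxL] at hx
  obtain ⟨ε, hε, hεV⟩ := Metric.isOpen_iff.1 hV x hxV
  have hge : ∀ᶠ r in 𝓝[>] (0 : ℝ), ENNReal.ofReal (k / 2) ≤
      volume (L ∩ Metric.closedBall x r) / volume (Metric.closedBall x r) := by
    filter_upwards [Ioo_mem_nhdsGT hε] with r hr
    have hr₀ : 0 < r := hr.1
    rw [Real.volume_closedBall, ENNReal.le_div_iff_mul_le (by simp [hr₀]) (Or.inl ENNReal.ofReal_ne_top),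
      ← ENNReal.ofReal_mul (by positivity)]
    calc ENNReal.ofReal (k / 2 * (2 * r)) = ENNReal.ofReal (k * r) := by ring_nf
      _ ≤ volume (L ∩ Metric.ball x r) :=
          hdens x r hr₀ ((Metric.ball_subset_ball hr.2.le).trans hεV)
      _ ≤ volume (L ∩ Metric.closedBall x r) :=
          measure_mono (Set.inter_subset_inter_right _ Metric.ball_subset_closedBall)
  have hle := ENNReal.ofReal_eq_zero.1 (le_antisymm (ge_of_tendsto hx hge) zero_le)
  linarith

/-- A limsup of open sets inherits a lower bound on the measure of the tails in a ball. -/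
theorem le_measure_iInter_iUnion_inter_ball {A : ℕ → Set ℝ} (hA : ∀ t, IsOpen (A t)) {k y r : ℝ}
    (hle : ∀ M : ℕ, k ≤ volume.real ((⋃ t ≥ M, A t) ∩ Metric.ball y r)) :
    ENNReal.ofReal k ≤ volume ((⋂ M : ℕ, ⋃ t ≥ M, A t) ∩ Metric.ball y r) := by
  have hfin : ∀ M : ℕ, volume ((⋃ t ≥ M, A t) ∩ Metric.ball y r) ≠ ⊤ := fun M =>
    measure_ne_top_of_subset Set.inter_subset_right measure_ball_lt_top.ne
  rw [Set.iInter_inter]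
  refine ge_of_tendsto' (tendsto_measure_iInter_atTop (fun M => ?_) (fun M M' h => ?_) ⟨0, hfin 0⟩)
    fun M => ?_
  · exact ((isOpen_biUnion fun t _ => hA t).inter Metric.isOpen_ball).measurableSet.nullMeasurableSet
  · exact Set.inter_subset_inter_left _
      (Set.biUnion_subset_biUnion_left fun t (ht : M' ≤ t) => h.trans ht)
  · exact (ENNReal.ofReal_le_iff_le_toReal (hfin M)).2 (hle M)

theorem ubiquity_khintchine_lemma
    (I₀ : Set ℝ) (hI₀ : I₀.OrdConnected)
    (J : Type*) [Countable J] [Infinite J]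
    (R : J → ℝ) (hR : ∀ α, R α ∈ I₀)
    (β : J → ℝ) (hβ : ∀ α, 0 < β α)
    (hfin : ∀ t : ℕ, {α : J | β α ≤ (2 : ℝ) ^ t}.Finite)
    (ρ : ℝ → ℝ) (hρpos : ∀ t : ℝ, 0 < t → 0 < ρ t)
    (hρ0 : Tendsto ρ atTop (nhds 0))
    (hub : LocUbiq I₀ R β ρ)
    (Ψ : ℝ → ℝ) (hΨ : IsApproxFun Ψ)
    (hreg : ∀ᶠ t : ℕ in atTop, Ψ ((2 : ℝ) ^ (t + 1)) ≤ Ψ ((2 : ℝ) ^ t) / 2)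
    (hdiv : ¬ Summable (fun t : ℕ => Ψ ((2 : ℝ) ^ t) / ρ ((2 : ℝ) ^ t))) :
    volume (LambdaSet I₀ R β Ψ) = volume I₀ := by
  obtain ⟨hΨanti, hΨpos⟩ := hΨ
  obtain ⟨κ, hκ, hub⟩ := hub
  set ψ : ℕ → ℝ := fun t => Ψ ((2 : ℝ) ^ t) with hψdef
  have hψ : ∀ t, 0 < ψ t := fun t => hΨpos _ (by positivity)
  have hanti : Antitone ψ := fun s t h =>
    hΨanti _ _ (by positivity) (pow_le_pow_right₀ one_le_two h)
  have hψ₀ : Tendsto ψ atTop (𝓝 0) := by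
    refine (summable_of_ratio_norm_eventually_le (r := 1 / 2) (by norm_num) ?_).tendsto_atTop_zero
    filter_upwards [hreg] with t ht
    rw [Real.norm_of_nonneg (hψ _).le, Real.norm_of_nonneg (hψ _).le]
    linarith [show ψ (t + 1) ≤ ψ t / 2 from ht]
  set P : ℕ → Set ℝ := fun t => R '' {α | β α ≤ (2 : ℝ) ^ t} with hPdef
  set A : ℕ → Set ℝ := fun t => ⋃ c ∈ P t, Metric.ball c (ψ t) with hAdef
  have hA : ∀ t, IsOpen (A t) := fun t => isOpen_biUnion fun c _ => Metric.isOpen_ball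
  have hmem : ∀ᵐ x, x ∈ interior I₀ → x ∈ ⋂ M : ℕ, ⋃ t ≥ M, A t := by
    refine ae_mem_of_le_measure_inter_ball (k := (κ / 2) ^ 2 / 192)
      (MeasurableSet.iInter fun M => (isOpen_biUnion fun t _ => hA t).measurableSet)
      isOpen_interior (by positivity) fun y r hr hball => ?_
    refine le_measure_iInter_iUnion_inter_ball hA (le_measureReal_iUnion_inter_ball
      (fun t => (hfin t).image R) hr (half_pos hκ) (fun t => hρpos _ (by positivity))
      (hρ0.comp (tendsto_pow_atTop_atTop_of_one_lt one_lt_two)) hψ hψ₀ hanti hreg hdiv ?_)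
    have hliminf := hub (Metric.ball y (r / 2))
      (((Metric.ball_subset_ball (by linarith)).trans hball).trans interior_subset)
      (convex_ball y (r / 2)).ordConnected
    have hlt : ENNReal.ofReal (κ / 2 * r) < ENNReal.ofReal κ * volume (Metric.ball y (r / 2)) := by
      rw [Real.volume_ball, ← ENNReal.ofReal_mul hκ.le, ENNReal.ofReal_lt_ofReal_iff (by positivity)]
      nlinarith [mul_pos hκ hr]
    filter_upwards [eventually_lt_of_lt_liminf (hlt.trans_le hliminf)] with t ht
    simp only [Set.biUnion_image]
    exact ht.le
  have hfrontier : ∀ᵐ x, x ∉ frontier I₀ :=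
    measure_eq_zero_iff_ae_notMem.1 (hI₀.convex.addHaar_frontier volume)
  have hrange : ∀ᵐ x, x ∉ Set.range R :=
    measure_eq_zero_iff_ae_notMem.1 ((Set.countable_range R).measure_zero volume)
  refine measure_congr (Filter.eventuallyEq_set.2 ?_)
  filter_upwards [hmem, hfrontier, hrange] with x hx hxf hxR
  refine ⟨fun h => h.1, fun hxI => ⟨hxI, fun hfinite => ?_⟩⟩
  have hxint : x ∈ interior I₀ := by
    by_contra h
    exact hxf ⟨subset_closure hxI, h⟩
  have hclose : ∀ᶠ t in atTop, ∀ α ∈ {α : J | |x - R α| < Ψ (β α)}, ψ t < |x - R α| :=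
    (eventually_all_finite hfinite).2 fun α _ => hψ₀.eventually_lt_const
      (abs_pos.2 (sub_ne_zero.2 fun h => hxR ⟨α, h.symm⟩))
  obtain ⟨M, hM⟩ := eventually_atTop.1 hclose
  have hxM := Set.mem_iInter.1 (hx hxint) M
  simp only [hAdef, hPdef, Set.biUnion_image, Set.mem_iUnion] at hxM
  obtain ⟨t, htM, α, hα, hxα⟩ := hxM
  rw [Metric.mem_ball, Real.dist_eq] at hxα
  exact (hM t htM α (hxα.trans_le (hΨanti _ _ (hβ α) hα))).not_gt hxα
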